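/- arXiv:1209.0066 — 2 statements merged into one kernel-verified Lean document; each statement's English description precedes it below -/
import Mathlib

section
/- The function r ↦ E(r)/r'^{1/2} is strictly increasing on (0,1), with limit π/2 as r → 0⁺ and limit +∞ as r → 1⁻ (so it maps (0,1) onto (π/2, ∞)). -/
open Real Set Filter Topology

/-- The complete elliptic integral of the second kind. -/
noncomputable def ellipticE (r : ℝ) : ℝ :=
  ∫ θ in (0:ℝ)..(π/2), Real.sqrt (1 - r^2 * Real.sin θ ^ 2)

/-- The complete elliptic integral of the first kind. -/
noncomputable def ellipticK (r : ℝ) : ℝ :=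
  ∫ θ in (0:ℝ)..(π/2), (1 - r^2 * Real.sin θ ^ 2) ^ (-(1:ℝ)/2)

lemma sqrt_add_lt_aux {A B C D : ℝ} (hA : 0 ≤ A) (hC : 0 ≤ C)
    (hB : 0 ≤ B) (hD : 0 ≤ D)
    (h1 : A + B < C + D) (h2 : A * B ≤ C * D) : √A + √B < √C + √D := by
  apply lt_of_pow_lt_pow_left₀ 2 (by positivity)
  have h3 : √A * √B ≤ √C * √D := by
    rw [← Real.sqrt_mul hA, ← Real.sqrt_mul hC]
    exact Real.sqrt_le_sqrt h2
  have := Real.sq_sqrt hA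
  have := Real.sq_sqrt hB
  have := Real.sq_sqrt hC
  have := Real.sq_sqrt hD
  nlinarith

lemma pointwise_aux {a b c e : ℝ} (hab : a ^ 2 + b ^ 2 = 1) (he : 0 < e) (hec : e < c)
    (hc1 : c < 1) :
    √((1 - (1 - c ^ 2) * a ^ 2) / c) + √((1 - (1 - c ^ 2) * b ^ 2) / c) <
    √((1 - (1 - e ^ 2) * a ^ 2) / e) + √((1 - (1 - e ^ 2) * b ^ 2) / e) := by
  have hc : 0 < c := he.trans hec
  have key : ∀ x : ℝ, 0 < x → x < 1 → ∀ a b : ℝ, a ^ 2 + b ^ 2 = 1 →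
      (1 - (1 - x ^ 2) * a ^ 2) / x = b ^ 2 * x⁻¹ + a ^ 2 * x := by
    intro x hx hx1 a b hab
    field_simp
    linear_combination -hab
  have hba : b ^ 2 + a ^ 2 = 1 := by linarith
  rw [key c hc hc1 a b hab, key c hc hc1 b a hba, key e he (hec.trans hc1) a b hab,
    key e he (hec.trans hc1) b a hba]
  have hci : 1 < c⁻¹ := (one_lt_inv₀ hc).2 hc1
  have hei : c⁻¹ < e⁻¹ := (inv_lt_inv₀ hc he).2 hec
  have hcc : c * c⁻¹ = 1 := mul_inv_cancel₀ hc.ne'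
  have hee : e * e⁻¹ = 1 := mul_inv_cancel₀ he.ne'
  have hsum : c⁻¹ + c < e⁻¹ + e := by
    have h1 : 1 < c⁻¹ * e⁻¹ := by nlinarith
    have h2 : c - e = (c * e) * (e⁻¹ - c⁻¹) := by field_simp
    have h3 : c * e < 1 := by nlinarith
    nlinarith
  apply sqrt_add_lt_aux
  · positivity
  · positivity
  · positivity
  · positivity
  · calc _ = (a ^ 2 + b ^ 2) * (c⁻¹ + c) := by ring
      _ < (a ^ 2 + b ^ 2) * (e⁻¹ + e) := by rw [hab]; linarith
      _ = _ := by ring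
  · have hform : ∀ x : ℝ, x * x⁻¹ = 1 → (b ^ 2 * x⁻¹ + a ^ 2 * x) * (a ^ 2 * x⁻¹ + b ^ 2 * x)
        = (a ^ 2 - b ^ 2) ^ 2 + (a * b) ^ 2 * (x⁻¹ + x) ^ 2 := by
      intro x hx
      linear_combination (a ^ 4 + b ^ 4 - 2 * a ^ 2 * b ^ 2) * hx
    rw [hform c hcc, hform e hee]
    have : (c⁻¹ + c) ^ 2 ≤ (e⁻¹ + e) ^ 2 := by
      apply pow_le_pow_left₀ (by positivity) hsum.le
    nlinarith [mul_le_mul_of_nonneg_left this (sq_nonneg (a * b))]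

lemma ellipticE_cos (r : ℝ) :
    ellipticE r = ∫ θ in (0:ℝ)..(π/2), √(1 - r ^ 2 * Real.cos θ ^ 2) := by
  have := intervalIntegral.integral_comp_sub_left (a := 0) (b := π / 2)
    (fun θ : ℝ => √(1 - r ^ 2 * Real.sin θ ^ 2)) (π / 2)
  simp only [Real.sin_pi_div_two_sub, sub_self, sub_zero] at this
  rw [this, ellipticE]

lemma two_form {r : ℝ} (h1 : r ∈ Ioo (0:ℝ) 1) :
    2 * (ellipticE r / √(1 - r ^ 2) ^ ((1:ℝ)/2)) =
    ∫ θ in (0:ℝ)..(π/2), (√((1 - (1 - √(1 - r ^ 2) ^ 2) * Real.sin θ ^ 2) / √(1 - r ^ 2)) +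
      √((1 - (1 - √(1 - r ^ 2) ^ 2) * Real.cos θ ^ 2) / √(1 - r ^ 2))) := by
  have h0 : 0 ≤ 1 - r ^ 2 := by nlinarith [h1.1, h1.2]
  rw [Real.sq_sqrt h0, sub_sub_cancel, ← Real.sqrt_eq_rpow]
  simp only [Real.sqrt_div' _ (Real.sqrt_nonneg (1 - r ^ 2)), ← add_div]
  rw [intervalIntegral.integral_div, intervalIntegral.integral_add, ← ellipticE_cos]
  · rw [← ellipticE]; ring
  · apply Continuous.intervalIntegrable; fun_prop
  · apply Continuous.intervalIntegrable; fun_prop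

lemma ellipticE_cont : Continuous ellipticE := by
  unfold ellipticE
  apply intervalIntegral.continuous_parametric_intervalIntegral_of_continuous'
  unfold Function.uncurry
  fun_prop

/-- Lemma 2.2(2): r ↦ E(r)/r'^{1/2} is strictly increasing from (0,1) onto (π/2, ∞). -/
theorem stmt_3 :
    StrictMonoOn (fun r : ℝ => ellipticE r / Real.sqrt (1 - r^2) ^ ((1:ℝ)/2)) (Ioo 0 1) ∧
    Tendsto (fun r : ℝ => ellipticE r / Real.sqrt (1 - r^2) ^ ((1:ℝ)/2))
      (𝓝[>] 0) (𝓝 (π/2)) ∧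
    Tendsto (fun r : ℝ => ellipticE r / Real.sqrt (1 - r^2) ^ ((1:ℝ)/2))
      (𝓝[<] 1) atTop := by
  refine ⟨?_, ?_, ?_⟩
  · intro r hr s hs hrs
    have hr' := two_form hr
    have hs' := two_form hs
    have he : 0 < √(1 - s ^ 2) := Real.sqrt_pos.2 (by nlinarith [hs.1, hs.2])
    have hec : √(1 - s ^ 2) < √(1 - r ^ 2) :=
      Real.sqrt_lt_sqrt (by nlinarith [hs.1, hs.2]) (by nlinarith [hr.1])
    have hc1 : √(1 - r ^ 2) < 1 := by
      rw [Real.sqrt_lt' one_pos]; nlinarith [hr.1]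
    have hpw := fun θ : ℝ => pointwise_aux (Real.sin_sq_add_cos_sq θ) he hec hc1
    have hpi : (0:ℝ) < π / 2 := by positivity
    have := intervalIntegral.integral_lt_integral_of_continuousOn_of_le_of_exists_lt hpi
      (Continuous.continuousOn (by fun_prop)) (Continuous.continuousOn (by fun_prop))
      (fun θ _ => (hpw θ).le) ⟨0, ⟨le_rfl, hpi.le⟩, hpw 0⟩
    rw [← hr', ← hs'] at this
    show _ / _ < _ / _
    linarith
  · have h0 : ellipticE 0 = π / 2 := by simp [ellipticE]
    have : ContinuousAt (fun r : ℝ => ellipticE r / Real.sqrt (1 - r^2) ^ ((1:ℝ)/2)) 0 := by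
      simp only [← Real.sqrt_eq_rpow]
      apply ContinuousAt.div ellipticE_cont.continuousAt
      · fun_prop
      · simp
    have h2 := this.tendsto.mono_left (nhdsWithin_le_nhds (s := Ioi 0))
    simpa [h0] using h2
  · have h1 : ellipticE 1 = 1 := by
      unfold ellipticE
      have hcos : ∫ θ in (0:ℝ)..(π/2), Real.cos θ = 1 := by simp
      refine Eq.trans ?_ hcos
      apply intervalIntegral.integral_congr
      intro θ hθ
      rw [uIcc_of_le (by positivity)] at hθ
      have : 0 ≤ Real.cos θ := Real.cos_nonneg_of_mem_Icc ⟨by linarith [hθ.1, Real.pi_pos], hθ.2⟩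
      simp only [one_pow, one_mul]
      rw [← Real.cos_sq', Real.sqrt_sq this]
    simp only [← Real.sqrt_eq_rpow]
    simp only [div_eq_mul_inv]
    have hE : Tendsto ellipticE (𝓝[<] 1) (𝓝 1) := by
      have := ellipticE_cont.tendsto 1
      rw [h1] at this
      exact this.mono_left nhdsWithin_le_nhds
    apply hE.pos_mul_atTop one_pos
    apply Tendsto.inv_tendsto_nhdsGT_zero
    apply tendsto_nhdsWithin_iff.2 ⟨?_, ?_⟩
    · have : Continuous (fun r : ℝ => √√(1 - r ^ 2)) := by fun_prop
      have := this.tendsto 1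
      simp only [one_pow, sub_self, Real.sqrt_zero] at this
      exact this.mono_left nhdsWithin_le_nhds
    · filter_upwards [Ioo_mem_nhdsLT (show (0:ℝ) < 1 by norm_num)] with r hr
      exact Real.sqrt_pos.2 (Real.sqrt_pos.2 (by nlinarith [hr.1, hr.2]))
end

section
/- The function r ↦ (K(r) − E(r))/(r² K(r)) is strictly increasing on (0,1), with limit 1/2 as r → 0⁺ and limit 1 as r → 1⁻ (so it maps (0,1) onto (1/2, 1)). -/
open Real Set Filter Topology

lemma aux_pos {r : ℝ} (hr : r ∈ Ioo (0:ℝ) 1) {t : ℝ} (h1 : t ≤ 1) : 0 < 1 - r^2 * t := by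
  have h2 : r^2 < 1 := by nlinarith [hr.1, hr.2]
  nlinarith [sq_nonneg r, mul_nonneg (sq_nonneg r) (sub_nonneg.2 h1)]

lemma aux_cont {r : ℝ} (hr : r ∈ Ioo (0:ℝ) 1) :
    Continuous (fun θ : ℝ => (1 - r^2 * Real.sin θ ^ 2) ^ (-(1:ℝ)/2)) := by
  apply Continuous.rpow_const (by fun_prop)
  intro x
  exact Or.inl (aux_pos hr (Real.sin_sq_le_one x)).ne'

noncomputable def auxJ (r : ℝ) : ℝ :=
  ∫ θ in (0:ℝ)..(π/2), Real.sin θ ^ 2 * (1 - r^2 * Real.sin θ ^ 2) ^ (-(1:ℝ)/2)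

lemma aux_sqrt {x : ℝ} (hx : 0 < x) : Real.sqrt x = x * x ^ (-(1:ℝ)/2) := by
  rw [Real.sqrt_eq_rpow]
  nth_rewrite 2 [← Real.rpow_one x]
  rw [← Real.rpow_add hx]
  norm_num

lemma aux_KE {r : ℝ} (hr : r ∈ Ioo (0:ℝ) 1) : ellipticK r - ellipticE r = r^2 * auxJ r := by
  have hc := aux_cont hr
  unfold ellipticK ellipticE auxJ
  rw [← intervalIntegral.integral_sub (hc.intervalIntegrable _ _)
    (Continuous.intervalIntegrable (by fun_prop) _ _), ← intervalIntegral.integral_const_mul]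
  congr 1
  ext θ
  rw [aux_sqrt (aux_pos hr (Real.sin_sq_le_one θ))]
  ring

lemma aux_one_le {r : ℝ} (hr : r ∈ Ioo (0:ℝ) 1) (θ : ℝ) :
    1 ≤ (1 - r^2 * Real.sin θ ^ 2) ^ (-(1:ℝ)/2) :=
  Real.one_le_rpow_of_pos_of_le_one_of_nonpos (aux_pos hr (Real.sin_sq_le_one θ))
    (by nlinarith [mul_nonneg (sq_nonneg r) (sq_nonneg (Real.sin θ))]) (by norm_num)

lemma aux_le {r : ℝ} (hr : r ∈ Ioo (0:ℝ) 1) (θ : ℝ) :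
    (1 - r^2 * Real.sin θ ^ 2) ^ (-(1:ℝ)/2) ≤ (1 - r^2) ^ (-(1:ℝ)/2) := by
  apply Real.rpow_le_rpow_of_nonpos
  · simpa using aux_pos hr le_rfl
  · nlinarith [mul_nonneg (sq_nonneg r) (sub_nonneg.2 (Real.sin_sq_le_one θ))]
  · norm_num

lemma aux_sin_int : ∫ θ in (0:ℝ)..(π/2), Real.sin θ ^ 2 = π/4 := by
  rw [integral_sin_sq]; simp; ring

lemma aux_bounds {r : ℝ} (hr : r ∈ Ioo (0:ℝ) 1) :
    π/2 ≤ ellipticK r ∧ ellipticK r ≤ π/2 * (1 - r^2) ^ (-(1:ℝ)/2) ∧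
    π/4 ≤ auxJ r ∧ auxJ r ≤ π/4 * (1 - r^2) ^ (-(1:ℝ)/2) ∧ auxJ r ≤ ellipticK r := by
  have hc := aux_cont hr
  have hp : (0:ℝ) ≤ π/2 := by positivity
  have hs : Continuous (fun θ : ℝ => Real.sin θ ^ 2) := by fun_prop
  have i0 : IntervalIntegrable (fun θ : ℝ => Real.sin θ ^ 2) MeasureTheory.volume 0 (π/2) :=
    hs.intervalIntegrable _ _
  have i1 := hc.intervalIntegrable (μ := MeasureTheory.volume) 0 (π/2)
  have i2 := (hs.mul hc).intervalIntegrable (μ := MeasureTheory.volume) 0 (π/2)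
  refine ⟨?_, ?_, ?_, ?_, ?_⟩
  · have := intervalIntegral.integral_mono hp (g := fun θ : ℝ => (1 - r^2 * Real.sin θ ^ 2) ^ (-(1:ℝ)/2))
      (f := fun _ => (1:ℝ)) (by simp) i1 (fun θ => aux_one_le hr θ)
    simpa [ellipticK] using this
  · have := intervalIntegral.integral_mono hp (f := fun θ : ℝ => (1 - r^2 * Real.sin θ ^ 2) ^ (-(1:ℝ)/2))
      (g := fun _ => (1 - r^2) ^ (-(1:ℝ)/2)) i1 (by simp) (fun θ => aux_le hr θ)
    simpa [ellipticK] using this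
  · rw [← aux_sin_int]
    exact intervalIntegral.integral_mono hp i0 i2
      (fun θ => le_mul_of_one_le_right (sq_nonneg _) (aux_one_le hr θ))
  · rw [← aux_sin_int, ← intervalIntegral.integral_mul_const]
    exact intervalIntegral.integral_mono hp i2 (i0.mul_const _)
      (fun θ => mul_le_mul_of_nonneg_left (aux_le hr θ) (sq_nonneg _))
  · exact intervalIntegral.integral_mono hp i2 i1
      (fun θ => mul_le_of_le_one_left (zero_le_one.trans (aux_one_le hr θ)) (Real.sin_sq_le_one θ))

lemma aux_cross {r s : ℝ} (hr : r ∈ Ioo (0:ℝ) 1) (hs : s ∈ Ioo (0:ℝ) 1) (h : r < s) {m t : ℝ}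
    (hm : m ≤ 1) (ht : t ≤ 1) (hmt : m < t) :
    (1 - s^2 * m) ^ (-(1:ℝ)/2) * (1 - r^2 * t) ^ (-(1:ℝ)/2) <
    (1 - s^2 * t) ^ (-(1:ℝ)/2) * (1 - r^2 * m) ^ (-(1:ℝ)/2) := by
  have a := aux_pos hr hm
  have b := aux_pos hr ht
  have c := aux_pos hs hm
  have d := aux_pos hs ht
  rw [← Real.mul_rpow c.le b.le, ← Real.mul_rpow d.le a.le]
  apply Real.rpow_lt_rpow_of_neg (mul_pos d a) _ (by norm_num)
  have : r^2 < s^2 := by nlinarith [hr.1, hs.1]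
  nlinarith [mul_pos (sub_pos.2 this) (sub_pos.2 hmt)]

lemma aux_mono {r s : ℝ} (hr : r ∈ Ioo (0:ℝ) 1) (hs : s ∈ Ioo (0:ℝ) 1) (h : r < s) :
    auxJ r / ellipticK r < auxJ s / ellipticK s := by
  obtain ⟨k1, -, j1, -, jk⟩ := aux_bounds hr
  obtain ⟨k2, -, j2, -, -⟩ := aux_bounds hs
  have hpi := Real.pi_pos
  have hK : 0 < ellipticK r := by linarith
  have hK2 : 0 < ellipticK s := by linarith
  set m := auxJ r / ellipticK r with hm
  have hm0 : 0 < m := div_pos (by linarith) hK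
  have hm1 : m ≤ 1 := (div_le_one hK).2 jk
  rw [lt_div_iff₀ hK2]
  have hJ : auxJ r = m * ellipticK r := by rw [hm]; field_simp
  have cr := aux_cont hr
  have cs := aux_cont hs
  have hsn : Continuous (fun θ : ℝ => Real.sin θ ^ 2) := by fun_prop
  set A := (1 - r^2 * m) ^ (-(1:ℝ)/2) with hA
  set B := (1 - s^2 * m) ^ (-(1:ℝ)/2) with hB
  have hA0 : 0 < A := Real.rpow_pos_of_pos (aux_pos hr hm1) _
  have key : 0 < ∫ θ in (0:ℝ)..(π/2), (Real.sin θ ^ 2 - m) *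
      ((1 - s^2 * Real.sin θ ^ 2) ^ (-(1:ℝ)/2) * A - B * (1 - r^2 * Real.sin θ ^ 2) ^ (-(1:ℝ)/2)) := by
    have hpos : ∀ θ : ℝ, Real.sin θ ^ 2 ≠ m → 0 < (Real.sin θ ^ 2 - m) *
      ((1 - s^2 * Real.sin θ ^ 2) ^ (-(1:ℝ)/2) * A - B * (1 - r^2 * Real.sin θ ^ 2) ^ (-(1:ℝ)/2)) := by
      intro θ hθ
      rcases lt_or_gt_of_ne hθ with h1 | h1
      · have := aux_cross hr hs h (Real.sin_sq_le_one θ) hm1 h1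
        rw [← hA, ← hB] at this
        apply mul_pos_of_neg_of_neg <;> linarith
      · have := aux_cross hr hs h hm1 (Real.sin_sq_le_one θ) h1
        rw [← hA, ← hB] at this
        apply mul_pos <;> linarith
    apply intervalIntegral.integral_pos (by positivity)
    · exact ((hsn.sub continuous_const).mul
        ((cs.mul continuous_const).sub (continuous_const.mul cr))).continuousOn
    · intro θ _
      by_cases hθ : Real.sin θ ^ 2 = m
      · simp [hθ]
      · exact (hpos θ hθ).le
    · exact ⟨0, ⟨le_rfl, by positivity⟩, hpos 0 (by simpa using hm0.ne)⟩
  have e : (∫ θ in (0:ℝ)..(π/2), (Real.sin θ ^ 2 - m) *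
      ((1 - s^2 * Real.sin θ ^ 2) ^ (-(1:ℝ)/2) * A - B * (1 - r^2 * Real.sin θ ^ 2) ^ (-(1:ℝ)/2)))
      = A * (auxJ s - m * ellipticK s) - B * (auxJ r - m * ellipticK r) := by
    unfold auxJ ellipticK
    have i1 := cr.intervalIntegrable (μ := MeasureTheory.volume) 0 (π/2)
    have i2 : IntervalIntegrable (fun θ : ℝ => Real.sin θ ^ 2 * (1 - r^2 * Real.sin θ ^ 2) ^ (-(1:ℝ)/2))
      MeasureTheory.volume 0 (π/2) := (hsn.mul cr).intervalIntegrable 0 (π/2)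
    have i3 := cs.intervalIntegrable (μ := MeasureTheory.volume) 0 (π/2)
    have i4 : IntervalIntegrable (fun θ : ℝ => Real.sin θ ^ 2 * (1 - s^2 * Real.sin θ ^ 2) ^ (-(1:ℝ)/2))
      MeasureTheory.volume 0 (π/2) := (hsn.mul cs).intervalIntegrable 0 (π/2)
    have i5 : IntervalIntegrable (fun θ : ℝ => A * (Real.sin θ ^ 2 * (1 - s^2 * Real.sin θ ^ 2) ^ (-(1:ℝ)/2)
        - m * (1 - s^2 * Real.sin θ ^ 2) ^ (-(1:ℝ)/2))) MeasureTheory.volume 0 (π/2) :=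
      (i4.sub (i3.const_mul m)).const_mul A
    have i6 : IntervalIntegrable (fun θ : ℝ => B * (Real.sin θ ^ 2 * (1 - r^2 * Real.sin θ ^ 2) ^ (-(1:ℝ)/2)
        - m * (1 - r^2 * Real.sin θ ^ 2) ^ (-(1:ℝ)/2))) MeasureTheory.volume 0 (π/2) :=
      (i2.sub (i1.const_mul m)).const_mul B
    rw [← intervalIntegral.integral_const_mul m, ← intervalIntegral.integral_const_mul m,
      ← intervalIntegral.integral_sub i4 (i3.const_mul m),
      ← intervalIntegral.integral_sub i2 (i1.const_mul m),
      ← intervalIntegral.integral_const_mul, ← intervalIntegral.integral_const_mul,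
      ← intervalIntegral.integral_sub i5 i6]
    congr 1
    ext θ
    ring
  rw [e, hJ, sub_self, mul_zero, sub_zero] at key
  have := pos_of_mul_pos_right key hA0.le
  linarith

lemma aux_log {r : ℝ} (hr : r ∈ Ioo (0:ℝ) 1) :
    Real.log (π/2) - Real.log (√(1 - r^2)) ≤ ellipticK r := by
  have h0 : 0 < 1 - r^2 := by simpa using aux_pos hr le_rfl
  set ε := √(1 - r^2) with hε
  have he : 0 < ε := Real.sqrt_pos.2 h0
  have he2 : ε^2 = 1 - r^2 := Real.sq_sqrt h0.le
  have hpi := Real.pi_pos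
  have h1 : ∫ θ in (0:ℝ)..(π/2), (ε + π/2 - θ)⁻¹ = Real.log ((ε + π/2) / ε) := by
    rw [intervalIntegral.integral_comp_sub_left (fun x => x⁻¹), integral_inv_of_pos]
    · simp
    · simpa using he
    · linarith
  have h2 : ∫ θ in (0:ℝ)..(π/2), (ε + π/2 - θ)⁻¹ ≤ ellipticK r := by
    apply intervalIntegral.integral_mono_on (by positivity)
    · apply ContinuousOn.intervalIntegrable
      apply ContinuousOn.inv₀ (by fun_prop)
      intro x hx
      rw [uIcc_of_le (by positivity)] at hx
      linarith [hx.2]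
    · exact (aux_cont hr).intervalIntegrable _ _
    · intro x hx
      have hy : 0 ≤ π/2 - x := by linarith [hx.2]
      have hpos := aux_pos hr (Real.sin_sq_le_one x)
      have hcos : Real.cos x ≤ π/2 - x := by
        rw [← Real.sin_pi_div_two_sub]; exact Real.sin_le hy
      have hcos0 : 0 ≤ Real.cos x := Real.cos_nonneg_of_mem_Icc ⟨by linarith [hx.1], hx.2⟩
      have hb : 1 - r^2 * Real.sin x ^ 2 ≤ (ε + π/2 - x)^2 := by
        have : Real.cos x ^ 2 ≤ (π/2 - x)^2 := pow_le_pow_left₀ hcos0 hcos 2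
        have h3 : r^2 * Real.cos x ^ 2 ≤ Real.cos x ^ 2 := by
          nlinarith [sq_nonneg (Real.cos x)]
        have := Real.sin_sq_add_cos_sq x
        have h5 : r^2 * Real.sin x ^ 2 = r^2 - r^2 * Real.cos x ^ 2 := by
          rw [← mul_one_sub]; congr 1; linarith
        nlinarith [mul_nonneg he.le hy]
      have hq : 0 < ε + π/2 - x := by linarith
      rw [neg_div, Real.rpow_neg hpos.le, ← Real.sqrt_eq_rpow]
      apply inv_anti₀ (Real.sqrt_pos.2 hpos)
      exact (Real.sqrt_le_left hq.le).2 hb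
  rw [h1, Real.log_div (by positivity) he.ne'] at h2
  have : Real.log (π/2) ≤ Real.log (ε + π/2) := Real.log_le_log (by positivity) (by linarith)
  linarith

lemma aux_E {r : ℝ} : 0 ≤ ellipticE r ∧ ellipticE r ≤ π/2 := by
  have hp : (0:ℝ) ≤ π/2 := by positivity
  constructor
  · exact intervalIntegral.integral_nonneg hp (fun _ _ => Real.sqrt_nonneg _)
  · have := intervalIntegral.integral_mono (μ := MeasureTheory.volume) hp (f := fun θ : ℝ => √(1 - r^2 * Real.sin θ ^ 2))
      (g := fun _ => (1:ℝ)) (Continuous.intervalIntegrable (by fun_prop) _ _)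
      (continuous_const.intervalIntegrable _ _)
      (fun θ => Real.sqrt_le_one.2
        (by nlinarith [mul_nonneg (sq_nonneg r) (sq_nonneg (Real.sin θ))]))
    simpa [ellipticE] using this

lemma aux_Ktop : Tendsto ellipticK (𝓝[<] 1) atTop := by
  have hmem : Ioo (0:ℝ) 1 ∈ 𝓝[<] (1:ℝ) := Ioo_mem_nhdsLT one_pos
  have h1 : Tendsto (fun r : ℝ => √(1 - r^2)) (𝓝[<] 1) (𝓝[>] 0) := by
    apply tendsto_nhdsWithin_iff.2 ⟨?_, ?_⟩
    · have : Continuous (fun r : ℝ => √(1 - r^2)) := by fun_prop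
      have := (this.tendsto 1).mono_left (nhdsWithin_le_nhds (s := Iio 1))
      simpa using this
    · filter_upwards [hmem] with r hr
      exact Real.sqrt_pos.2 (by simpa using aux_pos hr le_rfl)
  have h2 : Tendsto (fun r : ℝ => Real.log (π/2) + - Real.log (√(1 - r^2))) (𝓝[<] 1) atTop :=
    tendsto_atTop_add_const_left _ _
      (tendsto_neg_atBot_atTop.comp (Real.tendsto_log_nhdsGT_zero.comp h1))
  apply tendsto_atTop_mono' _ _ h2
  filter_upwards [hmem] with r hr
  have := aux_log hr
  linarith

/-- Lemma 2.2(3): r ↦ (K(r) − E(r))/(r²K(r)) is strictly increasing from (0,1) onto (1/2, 1). -/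
theorem stmt_4 :
    StrictMonoOn (fun r : ℝ => (ellipticK r - ellipticE r) / (r^2 * ellipticK r)) (Ioo 0 1) ∧
    Tendsto (fun r : ℝ => (ellipticK r - ellipticE r) / (r^2 * ellipticK r))
      (𝓝[>] 0) (𝓝 (1/2)) ∧
    Tendsto (fun r : ℝ => (ellipticK r - ellipticE r) / (r^2 * ellipticK r))
      (𝓝[<] 1) (𝓝 1) := by
  have hF : ∀ r ∈ Ioo (0:ℝ) 1, (ellipticK r - ellipticE r) / (r^2 * ellipticK r)
      = auxJ r / ellipticK r := by
    intro r hr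
    rw [aux_KE hr, mul_div_mul_left _ _ (pow_ne_zero 2 hr.1.ne')]
  have hpi := Real.pi_pos
  refine ⟨?_, ?_, ?_⟩
  · intro r hr s hs h
    simp only [hF r hr, hF s hs]
    exact aux_mono hr hs h
  · have hmem : Ioo (0:ℝ) 1 ∈ 𝓝[>] (0:ℝ) := Ioo_mem_nhdsGT one_pos
    have hc : Tendsto (fun r : ℝ => (1 - r^2) ^ (-(1:ℝ)/2)) (𝓝[>] 0) (𝓝 1) := by
      have : ContinuousAt (fun r : ℝ => (1 - r^2) ^ (-(1:ℝ)/2)) 0 :=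
        ContinuousAt.rpow_const (by fun_prop) (Or.inl (by norm_num))
      have := this.tendsto.mono_left (nhdsWithin_le_nhds (s := Ioi 0))
      simpa using this
    have lo : Tendsto (fun r : ℝ => 1/2 * ((1 - r^2) ^ (-(1:ℝ)/2))⁻¹) (𝓝[>] 0) (𝓝 (1/2)) := by
      simpa using (hc.inv₀ one_ne_zero).const_mul (1/2:ℝ)
    have hi : Tendsto (fun r : ℝ => 1/2 * ((1 - r^2) ^ (-(1:ℝ)/2))) (𝓝[>] 0) (𝓝 (1/2)) := by
      simpa using hc.const_mul (1/2:ℝ)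
    apply tendsto_of_tendsto_of_tendsto_of_le_of_le' lo hi
    · filter_upwards [hmem] with r hr
      obtain ⟨a, b, c, d, -⟩ := aux_bounds hr
      have hw : 0 < (1 - r^2) ^ (-(1:ℝ)/2) :=
        Real.rpow_pos_of_pos (by simpa using aux_pos hr le_rfl) _
      rw [hF r hr, le_div_iff₀ (by linarith), mul_assoc, mul_comm _ (ellipticK r)]
      have : ellipticK r * ((1 - r^2) ^ (-(1:ℝ)/2))⁻¹ ≤ π/2 := by
        rw [← div_eq_mul_inv, div_le_iff₀ hw]; exact b
      linarith
    · filter_upwards [hmem] with r hr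
      obtain ⟨a, b, c, d, -⟩ := aux_bounds hr
      have hw : 0 < (1 - r^2) ^ (-(1:ℝ)/2) :=
        Real.rpow_pos_of_pos (by simpa using aux_pos hr le_rfl) _
      rw [hF r hr, div_le_iff₀ (by linarith)]
      nlinarith
  · have hmem : Ioo (0:ℝ) 1 ∈ 𝓝[<] (1:ℝ) := Ioo_mem_nhdsLT one_pos
    have hEK : Tendsto (fun r : ℝ => ellipticE r / ellipticK r) (𝓝[<] 1) (𝓝 0) := by
      have h3 : Tendsto (fun r : ℝ => (π/2) / ellipticK r) (𝓝[<] 1) (𝓝 0) :=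
        aux_Ktop.const_div_atTop _
      apply tendsto_of_tendsto_of_tendsto_of_le_of_le' tendsto_const_nhds h3
      · filter_upwards [hmem] with r hr
        exact div_nonneg aux_E.1 (by linarith [(aux_bounds hr).1])
      · filter_upwards [hmem] with r hr
        exact div_le_div_of_nonneg_right aux_E.2 (by linarith [(aux_bounds hr).1])
    have hr2 : Tendsto (fun r : ℝ => r^2) (𝓝[<] 1) (𝓝 1) := by
      have : Continuous (fun r : ℝ => r^2) := by fun_prop
      have := (this.tendsto 1).mono_left (nhdsWithin_le_nhds (s := Iio 1))
      simpa using this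
    have h4 : Tendsto (fun r : ℝ => (1 - ellipticE r / ellipticK r) / r^2) (𝓝[<] 1) (𝓝 1) := by
      have h5 := (hEK.const_sub 1).div hr2 one_ne_zero
      rw [sub_zero, div_one] at h5
      exact h5
    apply h4.congr'
    filter_upwards [hmem] with r hr
    have hK : ellipticK r ≠ 0 := by have := (aux_bounds hr).1; intro h; linarith
    have := hr.1.ne'
    field_simp
end
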